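/- Let V be a filled sparsity pattern on {1,…,n}. If j is the parent of k in the elimination tree of V (i.e., I_k ≠ ∅ and j = min I_k), then I_k ⊆ I⁺_j and |I_k| ≤ |I_j| + 1. -/

import Mathlib

/-- A sparsity pattern on `{1,…,n}`: a set of pairs `(i,j)` with `n ≥ i > j ≥ 1`. -/
def IsPattern (n : ℕ) (V : Finset (ℕ × ℕ)) : Prop :=
  ∀ p ∈ V, 1 ≤ p.2 ∧ p.2 < p.1 ∧ p.1 ≤ n

/-- A pattern is filled (chordal) if `i > j > k`, `(i,k) ∈ V`, `(j,k) ∈ V` imply `(i,j) ∈ V`. -/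
def IsFilled (V : Finset (ℕ × ℕ)) : Prop :=
  ∀ i j k : ℕ, k < j → j < i → (i, k) ∈ V → (j, k) ∈ V → (i, j) ∈ V

/-- `I_k = {i : i > k, (i,k) ∈ V}`. -/
def lowerNbrs (V : Finset (ℕ × ℕ)) (k : ℕ) : Finset ℕ :=
  (V.filter (fun p => p.2 = k ∧ k < p.1)).image Prod.fst

/-- `I⁺_k = {k} ∪ I_k`. -/
def lowerNbrsPlus (V : Finset (ℕ × ℕ)) (k : ℕ) : Finset ℕ :=
  insert k (lowerNbrs V k)

/-- `j` is the parent of `k` in the elimination tree: `I_k ≠ ∅` and `j = min I_k`. -/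
def ParentOf (V : Finset (ℕ × ℕ)) (j k : ℕ) : Prop :=
  j ∈ lowerNbrs V k ∧ ∀ i ∈ lowerNbrs V k, j ≤ i

/-- `j` is an ancestor of `k`: `j` is obtained from `k` by iterating the parent map
zero or more times. -/
def EtreeAncestor (V : Finset (ℕ × ℕ)) (j k : ℕ) : Prop :=
  Relation.ReflTransGen (fun a b => ParentOf V b a) k j

/-- `j` is a proper ancestor of `k`: obtained by iterating the parent map at least once. -/
def EtreeProperAncestor (V : Finset (ℕ × ℕ)) (j k : ℕ) : Prop :=
  Relation.TransGen (fun a b => ParentOf V b a) k j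

/-- A set `W` of vertices is complete for `V`: all pairs in `W` are joined in `V`. -/
def IsCompleteSet (V : Finset (ℕ × ℕ)) (W : Finset ℕ) : Prop :=
  ∀ i ∈ W, ∀ j ∈ W, j < i → (i, j) ∈ V

/-- A clique: a complete subset of `{1,…,n}` maximal with respect to inclusion. -/
def IsCliqueOf (n : ℕ) (V : Finset (ℕ × ℕ)) (W : Finset ℕ) : Prop :=
  W ⊆ Finset.Icc 1 n ∧ IsCompleteSet V W ∧
    ∀ W' ⊆ Finset.Icc 1 n, IsCompleteSet V W' → W ⊆ W' → W = W'

theorem mem_lowerNbrs_iff (V : Finset (ℕ × ℕ)) (k i : ℕ) :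
    i ∈ lowerNbrs V k ↔ (i, k) ∈ V ∧ k < i := by
  unfold lowerNbrs
  simp only [Finset.mem_image, Finset.mem_filter]
  constructor
  · rintro ⟨⟨a, b⟩, ⟨h1, h2, h3⟩, h4⟩
    simp only at h2 h3 h4
    subst h2 h4
    exact ⟨h1, h3⟩
  · rintro ⟨h1, h2⟩
    exact ⟨(i, k), ⟨h1, rfl, h2⟩, rfl⟩

/-- If `j` is the parent of `k` in the elimination tree, then `I_k ⊆ I⁺_j` and
`|I_k| ≤ |I_j| + 1`. -/
theorem stmt_2 (n : ℕ) (hn : 1 ≤ n) (V : Finset (ℕ × ℕ))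
    (hV : IsPattern n V) (hF : IsFilled V) (j k : ℕ)
    (h : ParentOf V j k) :
    lowerNbrs V k ⊆ lowerNbrsPlus V j ∧
    (lowerNbrs V k).card ≤ (lowerNbrs V j).card + 1 := by
  have hsub : lowerNbrs V k ⊆ lowerNbrsPlus V j := by
    intro i hi
    have hle := h.2 i hi
    have hj := (mem_lowerNbrs_iff V k j).1 h.1
    have hi' := (mem_lowerNbrs_iff V k i).1 hi
    unfold lowerNbrsPlus
    rw [Finset.mem_insert, mem_lowerNbrs_iff]
    rcases hle.eq_or_lt with e | l
    · exact Or.inl e.symm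
    · exact Or.inr ⟨hF i j k hj.2 l hi'.1 hj.1, l⟩
  exact ⟨hsub, (Finset.card_le_card hsub).trans (Finset.card_insert_le _ _)⟩
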